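/- arXiv:1908.02050 — 7 statements merged into one kernel-verified Lean document; each statement's English description precedes it below -/
import Mathlib

section
/- Let G = (V,E) be a finite loopless multigraph and let D and D' be two orientations of G. Then the outdegree functions of D and D' coincide at every vertex (δ⁺_D(v) = δ⁺_{D'}(v) for all v ∈ V) if and only if D' can be obtained from D by reversing a set of pairwise arc-disjoint directed cycles of D. -/
section Defs

variable {V A E : Type*}

/-- A directed walk in the digraph given by `src`/`tgt`, from `u` to `v`,
recorded as its list of arcs. -/
def IsDiwalk (src tgt : A → V) : V → V → List A → Prop
  | u, v, [] => u = v
  | u, v, a :: p => src a = u ∧ IsDiwalk src tgt (tgt a) v p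

/-- A directed path from `u` to `v`: a directed walk whose vertices are pairwise distinct. -/
def IsDipath (src tgt : A → V) (u v : V) (p : List A) : Prop :=
  IsDiwalk src tgt u v p ∧ (u :: p.map tgt).Nodup

/-- A directed cycle: a nonempty closed directed walk whose vertices are pairwise distinct. -/
def IsDicycle (src tgt : A → V) (p : List A) : Prop :=
  p ≠ [] ∧ ∃ u, IsDiwalk src tgt u u p ∧ (p.map tgt).Nodup

/-- Source map of the digraph obtained by reversing the arcs in `B`. -/
noncomputable def rsrc (src tgt : A → V) (B : Set A) (a : A) : V :=
  haveI := Classical.propDecidable (a ∈ B)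
  if a ∈ B then tgt a else src a

/-- Target map of the digraph obtained by reversing the arcs in `B`. -/
noncomputable def rtgt (src tgt : A → V) (B : Set A) (a : A) : V :=
  haveI := Classical.propDecidable (a ∈ B)
  if a ∈ B then src a else tgt a

/-- The outdegree `δ⁺(X)` of a set of vertices: the number of arcs leaving `X`. -/
noncomputable def outdegS (src tgt : A → V) (X : Set V) : ℕ :=
  Nat.card {a : A // src a ∈ X ∧ tgt a ∉ X}

/-- The outdegree `δ⁺(v)` of a vertex: the number of arcs with source `v`. -/
noncomputable def outdegV (src tgt : A → V) (v : V) : ℕ :=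
  Nat.card {a : A // src a = v}

/-- A digraph is `k`-arc-connected if every nonempty proper vertex subset
has outdegree at least `k`. -/
def IsKConnected (src tgt : A → V) (k : ℕ) : Prop :=
  ∀ X : Set V, X.Nonempty → X ≠ Set.univ → k ≤ outdegS src tgt X

/-- `λ(u,v)`: the maximum number of pairwise arc-disjoint directed paths from `u` to `v`
(with value `⊤` when this is unbounded, e.g. for `u = v`). -/
noncomputable def lambdaConn (src tgt : A → V) (u v : V) : ℕ∞ :=
  sSup ((fun m : ℕ => (m : ℕ∞)) '' {m : ℕ | ∃ Ps : Fin m → List A,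
    (∀ i, IsDipath src tgt u v (Ps i)) ∧
    Pairwise fun i j => (Ps i).Disjoint (Ps j)})

/-- An orientation of the multigraph on vertex set `V` with edge set `E` and
endpoint map `ends : E → Sym2 V`. -/
structure GraphOrientation (V : Type*) (E : Type*) (ends : E → Sym2 V) where
  src : E → V
  tgt : E → V
  compat : ∀ e, s(src e, tgt e) = ends e

/-- The orientation obtained from `D` by reversing the arcs in `B`. -/
noncomputable def GraphOrientation.rev {ends : E → Sym2 V} (D : GraphOrientation V E ends) (B : Set E) :
    GraphOrientation V E ends where
  src := rsrc D.src D.tgt B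
  tgt := rtgt D.src D.tgt B
  compat := by
    intro e
    unfold rsrc rtgt
    split
    · rw [Sym2.eq_swap]; exact D.compat e
    · exact D.compat e

end Defs


section Helpers

open Classical

/-- Balanced arc sets: at every vertex, as many arcs of `B` leave as enter. -/
def BalancedArcs {V E : Type*} (src tgt : E → V) (B : Finset E) : Prop :=
  ∀ v, (B.filter (fun e => src e = v)).card = (B.filter (fun e => tgt e = v)).card

theorem diwalk_map {V E : Type*} (src tgt : E → V) (p : List E) :
    ∀ u v, IsDiwalk src tgt u v p → p.map src ++ [v] = u :: p.map tgt := by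
  induction p with
  | nil => intro u v h; simp only [IsDiwalk] at h; simp [h]
  | cons a p ih =>
    intro u v h
    obtain ⟨h1, h2⟩ := h
    simp [ih _ _ h2, h1]

theorem card_filter_toFinset {V E : Type*} (f : E → V) (p : List E) (hp : p.Nodup) (v : V) :
    (p.toFinset.filter (fun e => f e = v)).card = (p.map f).count v := by
  have h0 : p.toFinset.filter (fun e => f e = v) =
      (p.filter (fun e => decide (f e = v))).toFinset := by
    ext e
    simp
  rw [h0, List.toFinset_card_of_nodup (hp.filter _),
    ← List.countP_eq_length_filter, List.count, List.countP_map]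
  congr 1

theorem dicycle_nodup {V E : Type*} {src tgt : E → V} {p : List E}
    (h : IsDicycle src tgt p) : p.Nodup := by
  obtain ⟨_, u, _, h⟩ := h
  exact List.Nodup.of_map _ h

theorem dicycle_balanced {V E : Type*} {src tgt : E → V} {p : List E}
    (h : IsDicycle src tgt p) : BalancedArcs src tgt p.toFinset := by
  intro v
  have hn := dicycle_nodup h
  obtain ⟨_, u, hw, _⟩ := h
  rw [card_filter_toFinset _ _ hn, card_filter_toFinset _ _ hn]
  have := congrArg (List.count v) (diwalk_map src tgt p u u hw)
  simp only [List.count_append, List.count_cons, List.count_nil] at this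
  omega

theorem diwalk_iterate {V E W : Type*} (src tgt : E → V) (i : W → V) (c : W → E) (h : W → W)
    (hs : ∀ w, src (c w) = i w) (ht : ∀ w, tgt (c w) = i (h w)) (n : ℕ) :
    ∀ w, IsDiwalk src tgt (i w) (i (h^[n] w)) ((List.iterate h w n).map c) := by
  induction n with
  | zero => intro w; simp [IsDiwalk]
  | succ n ih =>
    intro w
    simp only [List.iterate, List.map_cons, IsDiwalk, Function.iterate_succ, Function.comp]
    refine ⟨hs w, ?_⟩
    rw [ht]
    exact ih (h w)

theorem exists_periodic {W : Type*} [Finite W] (h : W → W) (x : W) :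
    ∃ w, w ∈ Function.periodicPts h := by
  obtain ⟨i, j, hij, he⟩ := Finite.exists_ne_map_eq_of_infinite (fun n : ℕ => h^[n] x)
  wlog hlt : i < j generalizing i j
  · exact this j i hij.symm he.symm (by omega)
  refine ⟨h^[i] x, j - i, by omega, ?_⟩
  change h^[j - i] (h^[i] x) = h^[i] x
  rw [← Function.iterate_add_apply, Nat.sub_add_cancel hlt.le]
  exact he.symm

theorem exists_dicycle {V E : Type*} (src tgt : E → V) (B : Finset E)
    (hB : BalancedArcs src tgt B) (hne : B.Nonempty) :
    ∃ p, IsDicycle src tgt p ∧ p.toFinset ⊆ B := by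
  let W := {v : V // v ∈ B.image src}
  have hc : ∀ w : W, ∃ e ∈ B, src e = w.1 := fun w => by
    exact Finset.mem_image.1 w.2
  choose c hcB hcs using hc
  have hmem : ∀ e ∈ B, tgt e ∈ B.image src := by
    intro e he
    have h1 : 0 < (B.filter (fun e' => tgt e' = tgt e)).card :=
      Finset.card_pos.2 ⟨e, by simp [he]⟩
    rw [← hB] at h1
    obtain ⟨e', he'⟩ := Finset.card_pos.1 h1
    rw [Finset.mem_filter] at he'
    exact Finset.mem_image.2 ⟨e', he'⟩
  let h : W → W := fun w => ⟨tgt (c w), hmem _ (hcB w)⟩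
  obtain ⟨e0, he0⟩ := hne
  obtain ⟨w, hw⟩ := exists_periodic h ⟨src e0, Finset.mem_image_of_mem _ he0⟩
  have hpos := Function.minimalPeriod_pos_of_mem_periodicPts hw
  have hper : h^[Function.minimalPeriod h w] w = w := Function.iterate_minimalPeriod
  have hwalk := diwalk_iterate src tgt (fun w : W => w.1) c h hcs (fun w => rfl)
    (Function.minimalPeriod h w) w
  rw [hper] at hwalk
  refine ⟨(List.iterate h w (Function.minimalPeriod h w)).map c, ⟨?_, w.1, hwalk, ?_⟩, ?_⟩
  · intro h0
    have := congrArg List.length h0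
    simp at this
    omega
  · have hm := diwalk_map src tgt _ _ _ hwalk
    have hp : (List.map tgt ((List.iterate h w (Function.minimalPeriod h w)).map c)).Perm
        (List.map src ((List.iterate h w (Function.minimalPeriod h w)).map c)) := by
      rw [← List.perm_cons w.1, ← hm]
      exact List.perm_append_singleton _ _
    rw [hp.nodup_iff, List.map_map]
    refine List.Nodup.map ?_ ?_
    · intro a b hab
      simp only [Function.comp, hcs] at hab
      exact Subtype.ext hab
    · rw [← List.range_map_iterate]
      refine List.Nodup.map_on ?_ List.nodup_range
      intro a ha b hb hab
      exact Function.iterate_injOn_Iio_minimalPeriod (by simpa using ha) (by simpa using hb) hab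
  · intro e he
    simp only [List.mem_toFinset, List.mem_map] at he
    obtain ⟨a, _, rfl⟩ := he
    exact hcB a

theorem balanced_decomp {V E : Type*} (src tgt : E → V) (n : ℕ) :
    ∀ B : Finset E, B.card = n → BalancedArcs src tgt B →
    ∃ 𝒞 : Set (List E), (∀ p ∈ 𝒞, IsDicycle src tgt p) ∧
      (∀ p ∈ 𝒞, ∀ q ∈ 𝒞, p ≠ q → p.Disjoint q) ∧
      ∀ e, e ∈ B ↔ ∃ p ∈ 𝒞, e ∈ p := by
  induction n using Nat.strong_induction_on with
  | _ n ih =>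
    intro B hn hB
    rcases B.eq_empty_or_nonempty with rfl | hne
    · exact ⟨∅, by simp, by simp, by simp⟩
    obtain ⟨p, hp, hpB⟩ := exists_dicycle src tgt B hB hne
    have hpne : p.toFinset.Nonempty := by
      rw [List.toFinset_nonempty_iff]; exact hp.1
    have hlt : (B \ p.toFinset).card < n := by
      rw [← hn]
      exact Finset.card_lt_card (Finset.sdiff_ssubset hpB hpne)
    have hsplit : ∀ f : E → V, ∀ v, (B.filter (fun e => f e = v)).card =
        ((B \ p.toFinset).filter (fun e => f e = v)).card +
        (p.toFinset.filter (fun e => f e = v)).card := by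
      intro f v
      rw [← Finset.card_union_of_disjoint
        (Finset.disjoint_filter_filter Finset.sdiff_disjoint),
        ← Finset.filter_union, Finset.sdiff_union_of_subset hpB]
    obtain ⟨C, h1, h2, h3⟩ := ih _ hlt (B \ p.toFinset) rfl (by
      intro v
      have a1 := hsplit src v
      have a2 := hsplit tgt v
      have a3 := hB v
      have a4 := dicycle_balanced hp v
      omega)
    have hd : ∀ q ∈ C, ∀ e ∈ q, e ∉ p := by
      intro q hq e he hep
      have := (h3 e).2 ⟨q, hq, he⟩
      simp [hep] at this
    refine ⟨insert p C, ?_, ?_, ?_⟩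
    · rintro q (rfl | hq)
      · exact hp
      · exact h1 q hq
    · rintro q (rfl | hq) r (rfl | hr) hqr
      · exact absurd rfl hqr
      · intro e he her
        exact hd r hr e her he
      · intro e he her
        exact hd q hq e he her
      · exact h2 q hq r hr hqr
    · intro e
      have h3e := h3 e
      simp only [Finset.mem_sdiff, List.mem_toFinset] at h3e
      have hs : e ∈ p → e ∈ B := fun h => hpB (by simpa using h)
      simp only [Set.mem_insert_iff, exists_eq_or_imp]
      rw [← h3e]
      tauto

theorem balanced_union {V E : Type*} [Fintype E] (src tgt : E → V) (C : Set (List E))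
    (h1 : ∀ p ∈ C, IsDicycle src tgt p)
    (h2 : ∀ p ∈ C, ∀ q ∈ C, p ≠ q → p.Disjoint q) :
    BalancedArcs src tgt (Finset.univ.filter (fun e => ∃ p ∈ C, e ∈ p)) := by
  have hfin : C.Finite := by
    refine Set.Finite.subset (List.finite_length_le E (Fintype.card E)) ?_
    intro p hp
    exact (dicycle_nodup (h1 p hp)).length_le_card
  intro v
  have key : ∀ f : E → V,
      ((Finset.univ.filter (fun e => ∃ p ∈ C, e ∈ p)).filter (fun e => f e = v)).card =
      ∑ p ∈ hfin.toFinset, (p.toFinset.filter (fun e => f e = v)).card := by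
    intro f
    rw [← Finset.card_biUnion]
    · congr 1
      ext e
      simp only [Finset.mem_filter, Finset.mem_univ, true_and, Finset.mem_biUnion,
        Set.Finite.mem_toFinset, List.mem_toFinset]
      constructor
      · rintro ⟨⟨p, hp, he⟩, hv⟩
        exact ⟨p, hp, he, hv⟩
      · rintro ⟨p, hp, he, hv⟩
        exact ⟨⟨p, hp, he⟩, hv⟩
    · intro p hp q hq hpq
      refine Finset.disjoint_filter_filter ?_
      rw [List.disjoint_toFinset_iff_disjoint]
      exact h2 p (by simpa using hp) q (by simpa using hq) hpq
  rw [key, key]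
  refine Finset.sum_congr rfl fun p hp => ?_
  exact dicycle_balanced (h1 p (by simpa using hp)) v

theorem outdeg_iff_balanced {V E : Type*} [Fintype E] (src tgt : E → V) (B : Set E) (v : V) :
    outdegV src tgt v = outdegV (rsrc src tgt B) (rtgt src tgt B) v ↔
    ((Finset.univ.filter (fun e => e ∈ B)).filter (fun e => src e = v)).card =
    ((Finset.univ.filter (fun e => e ∈ B)).filter (fun e => tgt e = v)).card := by
  have e1 : outdegV src tgt v =
      ((Finset.univ.filter (fun e => e ∈ B)).filter (fun e => src e = v)).card +
      ((Finset.univ.filter (fun e => e ∉ B)).filter (fun e => src e = v)).card := by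
    rw [outdegV, Nat.card_eq_fintype_card, Fintype.card_subtype,
      ← Finset.card_filter_add_card_filter_not (s := Finset.univ.filter (fun e => src e = v))
        (fun e => e ∈ B), Finset.filter_comm, Finset.filter_comm (fun e => src e = v)]
  have e2 : outdegV (rsrc src tgt B) (rtgt src tgt B) v =
      ((Finset.univ.filter (fun e => e ∈ B)).filter (fun e => tgt e = v)).card +
      ((Finset.univ.filter (fun e => e ∉ B)).filter (fun e => src e = v)).card := by
    rw [outdegV, Nat.card_eq_fintype_card, Fintype.card_subtype,
      ← Finset.card_filter_add_card_filter_not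
        (s := Finset.univ.filter (fun e => rsrc src tgt B e = v)) (fun e => e ∈ B)]
    congr 2
    · ext e
      simp only [Finset.mem_filter, Finset.mem_univ, true_and]
      by_cases h : e ∈ B
      · have hr : rsrc src tgt B e = tgt e := by simp [rsrc, h]
        rw [hr]; tauto
      · tauto
    · ext e
      simp only [Finset.mem_filter, Finset.mem_univ, true_and]
      by_cases h : e ∈ B
      · tauto
      · have hr : rsrc src tgt B e = src e := by simp [rsrc, h]
        rw [hr]; tauto
  rw [e1, e2]
  omega

theorem eq_rev_diff {V E : Type*} {ends : E → Sym2 V} (D D' : GraphOrientation V E ends) :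
    D' = D.rev {e | D.src e ≠ D'.src e} := by
  have h : ∀ e, D'.src e = (D.rev {e | D.src e ≠ D'.src e}).src e ∧
      D'.tgt e = (D.rev {e | D.src e ≠ D'.src e}).tgt e := by
    intro e
    have hc := (D.compat e).trans (D'.compat e).symm
    rw [Sym2.eq_iff] at hc
    by_cases hs : D.src e = D'.src e
    · simp only [GraphOrientation.rev, rsrc, rtgt, Set.mem_ofPred_eq, hs, ne_eq,
        not_true_eq_false, if_false, true_and]
      rcases hc with hc | hc
      · exact hc.2.symm
      · rw [hc.2, ← hs, hc.1]
    · simp only [GraphOrientation.rev, rsrc, rtgt, Set.mem_ofPred_eq, hs, ne_eq,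
        not_false_eq_true, if_true]
      rcases hc with hc | hc
      · exact absurd hc.1 hs
      · exact ⟨hc.2.symm, hc.1.symm⟩
  generalize D.rev {e | D.src e ≠ D'.src e} = D'' at h
  cases D'
  cases D''
  simp only [GraphOrientation.mk.injEq]
  exact ⟨funext fun e => (h e).1, funext fun e => (h e).2⟩

end Helpers

/-- Two orientations of a finite loopless multigraph have the same
outdegree at every vertex iff one is obtained from the other by reversing a set of
pairwise arc-disjoint directed cycles. -/
theorem stmt_0 {V E : Type*} [Fintype V] [Fintype E]
    (ends : E → Sym2 V) (hloop : ∀ e, ¬ (ends e).IsDiag)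
    (D D' : GraphOrientation V E ends) :
    (∀ v, outdegV D.src D.tgt v = outdegV D'.src D'.tgt v) ↔
    ∃ 𝒞 : Set (List E),
      (∀ p ∈ 𝒞, IsDicycle D.src D.tgt p) ∧
      (∀ p ∈ 𝒞, ∀ q ∈ 𝒞, p ≠ q → p.Disjoint q) ∧
      D' = D.rev {e | ∃ p ∈ 𝒞, e ∈ p} := by
  classical
  constructor
  · intro h
    have hrev := eq_rev_diff D D'
    have hB : BalancedArcs D.src D.tgt
        (Finset.univ.filter (fun e => e ∈ {e | D.src e ≠ D'.src e})) := by
      intro v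
      have hv := h v
      rw [hrev] at hv
      convert (outdeg_iff_balanced D.src D.tgt {e | D.src e ≠ D'.src e} v).1 ?_
      conv at hv => rhs; rw [← hrev]
      rw [hv]
      conv_lhs => rw [hrev]
      rfl
    obtain ⟨C, h1, h2, h3⟩ := balanced_decomp D.src D.tgt _ _ rfl hB
    refine ⟨C, h1, h2, ?_⟩
    have hset : {e | ∃ p ∈ C, e ∈ p} = {e | D.src e ≠ D'.src e} := by
      ext e
      rw [Set.mem_ofPred_eq, ← h3 e]
      simp
    rw [hset]
    exact hrev
  · rintro ⟨C, h1, h2, rfl⟩ v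
    refine (outdeg_iff_balanced D.src D.tgt {e | ∃ p ∈ C, e ∈ p} v).2 ?_
    convert balanced_union D.src D.tgt C h1 h2 v
    all_goals exact Iff.rfl
end

section
/- Let G = (V,E) be a finite loopless multigraph, α : V → ℕ, and let D and D' both be α-orientations of G. Then D is k-arc-connected if and only if D' is k-arc-connected. -/
/-- The number of arcs with source in `X` is the sum of the outdegrees over `X`. -/
theorem card_src_mem {V E : Type*} [Fintype V] [Fintype E] (src tgt : E → V) (X : Set V) [Fintype X] :
    Nat.card {a : E // src a ∈ X} = ∑ v : X, outdegV src tgt v.1 := by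
  classical
  unfold outdegV
  rw [← Nat.card_sigma]
  exact Nat.card_congr
    { toFun := fun a => ⟨⟨src a.1, a.2⟩, ⟨a.1, rfl⟩⟩
      invFun := fun p => ⟨p.2.1, by rw [p.2.2]; exact p.1.2⟩
      left_inv := fun a => rfl
      right_inv := by
        rintro ⟨⟨v, hv⟩, ⟨a, ha⟩⟩
        have hb : src a = v := ha
        cases hb
        rfl }

/-- Arcs with source in `X` either leave `X` or are inside `X`. -/
theorem card_src_split {V E : Type*} [Fintype E] (src tgt : E → V) (X : Set V) :
    Nat.card {a : E // src a ∈ X} =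
      outdegS src tgt X + Nat.card {a : E // src a ∈ X ∧ tgt a ∈ X} := by
  classical
  unfold outdegS
  simp only [Nat.card_eq_fintype_card, Fintype.card_subtype]
  rw [← Finset.card_filter_add_card_filter_not (s := Finset.univ.filter fun a => src a ∈ X)
    (fun a => tgt a ∉ X)]
  simp only [Finset.filter_filter, not_not]

theorem outdegS_eq {V E : Type*} [Fintype V] [Fintype E]
    (ends : E → Sym2 V) (D D' : GraphOrientation V E ends)
    (h : ∀ v, outdegV D.src D.tgt v = outdegV D'.src D'.tgt v) (X : Set V) :
    outdegS D.src D.tgt X = outdegS D'.src D'.tgt X := by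
  classical
  have h1 := card_src_split D.src D.tgt X
  have h2 := card_src_split D'.src D'.tgt X
  rw [card_src_mem D.src D.tgt] at h1
  rw [card_src_mem D'.src D'.tgt] at h2
  have h3 : ∀ a, (D.src a ∈ X ∧ D.tgt a ∈ X) ↔ (D'.src a ∈ X ∧ D'.tgt a ∈ X) := by
    intro a
    have := (D.compat a).trans (D'.compat a).symm
    rw [Sym2.eq_iff] at this
    rcases this with ⟨p, q⟩ | ⟨p, q⟩
    · rw [p, q]
    · rw [p, q, and_comm]
  simp only [h, h3] at h1
  omega

/-- If `D` and `D'` are both `α`-orientations of a finite loopless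
multigraph, then `D` is `k`-arc-connected iff `D'` is `k`-arc-connected. -/
theorem stmt_3 {V E : Type*} [Fintype V] [Fintype E]
    (ends : E → Sym2 V) (hloop : ∀ e, ¬ (ends e).IsDiag)
    (α : V → ℕ) (k : ℕ) (D D' : GraphOrientation V E ends)
    (hD : ∀ v, outdegV D.src D.tgt v = α v)
    (hD' : ∀ v, outdegV D'.src D'.tgt v = α v) :
    IsKConnected D.src D.tgt k ↔ IsKConnected D'.src D'.tgt k := by
  have h := outdegS_eq ends D D' (fun v => (hD v).trans (hD' v).symm)
  simp only [IsKConnected, h]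
end

section
/- Let D be an orientation of a finite loopless multigraph G, let P be a directed path from a vertex u to a vertex v in D, let D' = D^P be the digraph obtained by reversing P, and let X ⊆ V(G). Then: (1) δ⁺_{D'}(X) = δ⁺_D(X) if u,v ∈ X or u,v ∉ X; (2) δ⁺_{D'}(X) = δ⁺_D(X) + 1 if u ∉ X and v ∈ X; (3) δ⁺_{D'}(X) = δ⁺_D(X) − 1 if u ∈ X and v ∉ X. -/
theorem diwalk_telescope {V A : Type*} (src tgt : A → V) (c : V → ℤ) (p : List A) :
    ∀ u v, IsDiwalk src tgt u v p → (p.map fun a => c (tgt a) - c (src a)).sum = c v - c u := by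
  induction p with
  | nil => intro u v h; simp only [IsDiwalk] at h; simp [h]
  | cons a p ih =>
    intro u v h
    simp only [IsDiwalk] at h
    have := ih _ _ h.2
    simp only [List.map_cons, List.sum_cons, this, h.1]
    ring

open Classical in
theorem outdegS_eq_sum {V A : Type*} [Fintype A] (src tgt : A → V) (X : Set V) :
    (outdegS src tgt X : ℤ) = ∑ a, if src a ∈ X ∧ tgt a ∉ X then (1 : ℤ) else 0 := by
  unfold outdegS
  rw [Nat.card_eq_fintype_card, Fintype.card_subtype, Finset.sum_boole]

open Classical in
theorem outdegS_rev {V A : Type*} [Fintype A] (src tgt : A → V)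
    (u v : V) (p : List A) (hp : IsDipath src tgt u v p) (X : Set V) :
    (outdegS (rsrc src tgt {a | a ∈ p}) (rtgt src tgt {a | a ∈ p}) X : ℤ) =
      outdegS src tgt X + ((if v ∈ X then 1 else 0) - (if u ∈ X then 1 else 0)) := by
  obtain ⟨hw, hn⟩ := hp
  have hpn : p.Nodup := List.Nodup.of_map tgt (List.nodup_cons.1 hn).2
  rw [← diwalk_telescope src tgt (fun w => if w ∈ X then (1 : ℤ) else 0) p u v hw,
    ← List.sum_toFinset _ hpn, outdegS_eq_sum, outdegS_eq_sum,
    ← sub_eq_iff_eq_add', ← Finset.sum_sub_distrib]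
  symm
  rw [← Finset.sum_subset (Finset.subset_univ p.toFinset)]
  · apply Finset.sum_congr rfl
    intro a ha
    have ha' : a ∈ p := by simpa using ha
    simp only [rsrc, rtgt, Set.mem_setOf_eq, ha', if_true]
    by_cases h1 : src a ∈ X <;> by_cases h2 : tgt a ∈ X <;> simp [h1, h2]
  · intro a _ ha
    have ha' : a ∉ p := by simpa using ha
    simp [rsrc, rtgt, ha']

/-- Reversing a directed path from `u` to `v` leaves `δ⁺(X)` unchanged
if `u, v` are on the same side of `X`, increases it by one if `u ∉ X ∋ v`, and
decreases it by one if `u ∈ X ∌ v`. -/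
theorem stmt_4 {V A : Type*} [Fintype V] [Fintype A]
    (src tgt : A → V) (hloop : ∀ a, src a ≠ tgt a)
    (u v : V) (p : List A) (hp : IsDipath src tgt u v p) (X : Set V) :
    (((u ∈ X ∧ v ∈ X) ∨ (u ∉ X ∧ v ∉ X)) →
      outdegS (rsrc src tgt {a | a ∈ p}) (rtgt src tgt {a | a ∈ p}) X =
        outdegS src tgt X) ∧
    ((u ∉ X ∧ v ∈ X) →
      outdegS (rsrc src tgt {a | a ∈ p}) (rtgt src tgt {a | a ∈ p}) X =
        outdegS src tgt X + 1) ∧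
    ((u ∈ X ∧ v ∉ X) →
      outdegS (rsrc src tgt {a | a ∈ p}) (rtgt src tgt {a | a ∈ p}) X =
        outdegS src tgt X - 1) := by
  have h := outdegS_rev src tgt u v p hp X
  refine ⟨?_, ?_, ?_⟩
  · rintro (⟨h1, h2⟩ | ⟨h1, h2⟩) <;> simp only [h1, h2, if_true, if_false] at h <;> omega
  · rintro ⟨h1, h2⟩
    simp only [h1, h2, if_true, if_false] at h
    omega
  · rintro ⟨h1, h2⟩
    simp only [h1, h2, if_true, if_false] at h
    omega
end

section
/- Let D be a finite digraph and let P_{uv} be a directed path from a vertex u to a vertex v in D. Then for all vertices u', v' one has λ_{D^{P_{uv}}}(u',v') ≥ min(λ_D(u,v) − 1, λ_D(u',v')). -/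
section Helpers

open Classical in
theorem aux_telescope {V A : Type*} (src tgt : A → V) (f : V → ℤ) (p : List A) :
    ∀ u v, IsDiwalk src tgt u v p → (p.map (fun a => f (src a) - f (tgt a))).sum = f u - f v := by
  induction p with
  | nil => intro u v h; simp only [IsDiwalk] at h; simp [h]
  | cons a p ih =>
    intro u v h
    simp only [IsDiwalk] at h
    obtain ⟨rfl, h⟩ := h
    simp [ih _ _ h]

theorem aux_nodup {V A : Type*} {src tgt : A → V} {u v : V} {p : List A}
    (h : IsDipath src tgt u v p) : p.Nodup :=
  List.Nodup.of_map tgt (List.nodup_cons.1 h.2).2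

open Classical in
theorem aux_telescopeF {V A : Type*} (src tgt : A → V) (f : V → ℤ) (p : List A) (u v : V)
    (h : IsDipath src tgt u v p) :
    ∑ a ∈ p.toFinset, (f (src a) - f (tgt a)) = f u - f v := by
  rw [List.sum_toFinset _ (aux_nodup h), aux_telescope src tgt f p u v h.1]

theorem aux_prefix {V A : Type*} (src tgt : A → V) (x : V) (p : List A) :
    ∀ u v, IsDipath src tgt u v p → x ∈ u :: p.map tgt →
      ∃ q, IsDipath src tgt u x q ∧ q <+: p := by
  induction p with
  | nil =>
    intro u v h hx
    simp at hx
    subst hx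
    exact ⟨[], ⟨rfl, by simp⟩, by simp⟩
  | cons a p ih =>
    intro u v h hx
    by_cases hxu : x = u
    · subst hxu
      exact ⟨[], ⟨rfl, by simp⟩, by simp⟩
    · obtain ⟨h1, h2⟩ := h
      simp only [IsDiwalk] at h1
      rw [List.map_cons, List.nodup_cons] at h2
      obtain ⟨q, hq, hqp⟩ := ih (tgt a) v ⟨h1.2, h2.2⟩ (by
        rcases List.mem_cons.1 hx with h | h
        · exact absurd h hxu
        · simpa using h)
      refine ⟨a :: q, ⟨⟨h1.1, hq.1⟩, ?_⟩, by simpa using hqp⟩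
      rw [List.map_cons, List.nodup_cons]
      refine ⟨fun hu => h2.1 ?_, hq.2⟩
      rcases List.mem_cons.1 hu with h | h
      · exact List.mem_cons.2 (Or.inl h)
      · exact List.mem_cons_of_mem _ ((hqp.map tgt).subset h)

theorem aux_walk_snoc {V A : Type*} (src tgt : A → V) (a : A) (p : List A) :
    ∀ u, IsDiwalk src tgt u (src a) p → IsDiwalk src tgt u (tgt a) (p ++ [a]) := by
  induction p with
  | nil => intro u h; simp only [IsDiwalk] at h; simp [IsDiwalk, h]
  | cons b p ih => intro u h; exact ⟨h.1, ih _ h.2⟩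

theorem aux_reach {V A : Type*} (src tgt : A → V) (S : Set A) (s t : V) :
    (∃ p, IsDipath src tgt s t p ∧ ∀ a ∈ p, a ∈ S) ∨
    ∃ X : Set V, s ∈ X ∧ t ∉ X ∧ ∀ a ∈ S, src a ∈ X → tgt a ∈ X := by
  by_cases h : ∃ p, IsDipath src tgt s t p ∧ ∀ a ∈ p, a ∈ S
  · exact Or.inl h
  refine Or.inr ⟨{x | ∃ p, IsDipath src tgt s x p ∧ ∀ a ∈ p, a ∈ S},
    ⟨[], ⟨rfl, by simp⟩, by simp⟩, h, ?_⟩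
  rintro a ha ⟨p, hp, hpS⟩
  by_cases hm : tgt a ∈ s :: p.map tgt
  · obtain ⟨q, hq, hqp⟩ := aux_prefix src tgt _ p _ _ hp hm
    exact ⟨q, hq, fun b hb => hpS b (hqp.subset hb)⟩
  · refine ⟨p ++ [a], ⟨aux_walk_snoc src tgt a p s hp.1, ?_⟩, ?_⟩
    · have : s :: (p ++ [a]).map tgt = (s :: p.map tgt) ++ [tgt a] := by simp
      rw [this]
      exact List.nodup_append.2 ⟨hp.2, by simp, by
        intro x hx y hy hxy
        simp at hy
        exact hm (hy ▸ hxy ▸ hx)⟩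
    · intro b hb
      rcases List.mem_append.1 hb with h | h
      · exact hpS b h
      · simp at h; exact h ▸ ha

/-- `F` is a 0-1 flow of value `k` from `s` to `t`. -/
def AuxFlow {V A : Type*} (src tgt : A → V) (s t : V) (F : Finset A) (k : ℕ) : Prop :=
  ∀ f : V → ℤ, ∑ a ∈ F, (f (src a) - f (tgt a)) = k * (f s - f t)

open Classical in
theorem aux_decomp {V A : Type*} (src tgt : A → V) (s t : V) (k : ℕ) :
    ∀ F : Finset A, AuxFlow src tgt s t F k → ∃ Ps : Fin k → List A,
    (∀ i, IsDipath src tgt s t (Ps i)) ∧ (∀ i, ∀ a ∈ Ps i, a ∈ F) ∧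
    Pairwise fun i j => (Ps i).Disjoint (Ps j) := by
  induction k with
  | zero => intro F _; exact ⟨fun _ => [], fun i => i.elim0, fun i => i.elim0, fun i => i.elim0⟩
  | succ k ih =>
    intro F hF
    rcases aux_reach src tgt (F : Set A) s t with ⟨p, hp, hpF⟩ | ⟨X, hs, ht, hX⟩
    · have hsub : p.toFinset ⊆ F := fun a ha => hpF a (List.mem_toFinset.1 ha)
      obtain ⟨Ps, h1, h2, h3⟩ := ih (F \ p.toFinset) (by
        intro f
        have e1 := Finset.sum_sdiff (f := fun a => f (src a) - f (tgt a)) hsub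
        rw [aux_telescopeF src tgt f p s t hp, hF f] at e1
        push_cast at e1
        linarith)
      have h2' : ∀ i, ∀ a ∈ Ps i, a ∈ F ∧ a ∉ p := fun i a ha => by
        simpa using h2 i a ha
      refine ⟨Fin.cons p Ps, ?_, ?_, ?_⟩
      · intro i; refine Fin.cases ?_ (fun i => ?_) i
        · simpa using hp
        · simpa using h1 i
      · intro i; refine Fin.cases ?_ (fun i => ?_) i
        · simpa using hpF
        · simpa using fun a ha => (h2' i a ha).1
      · intro i j
        refine Fin.cases ?_ (fun i => ?_) i <;> refine Fin.cases ?_ (fun j => ?_) j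
        · intro h; exact absurd rfl h
        · intro _ a ha hb
          simp only [Fin.cons_zero, Fin.cons_succ] at ha hb
          exact (h2' j a hb).2 ha
        · intro _ a ha hb
          simp only [Fin.cons_zero, Fin.cons_succ] at ha hb
          exact (h2' i a ha).2 hb
        · intro hij
          simp only [Fin.cons_succ]
          exact h3 (fun h => hij (by rw [h]))
    · exfalso
      have h := hF (fun x => if x ∈ X then 1 else 0)
      have h' : ∑ a ∈ F, ((if src a ∈ X then (1 : ℤ) else 0) - (if tgt a ∈ X then 1 else 0)) ≤ 0 := by
        apply Finset.sum_nonpos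
        intro a ha
        have := hX a ha
        split_ifs <;> simp_all
      simp only [hs, ht, if_true, if_false] at h
      rw [h] at h'
      push_cast at h'
      linarith

open Classical in
theorem aux_augment {V A : Type*} [Fintype A] (src tgt : A → V) (s t : V) (k : ℕ)
    (F : Finset A) (hF : AuxFlow src tgt s t F k) :
    (∃ F', AuxFlow src tgt s t F' (k + 1)) ∨
    ∃ X : Set V, s ∈ X ∧ t ∉ X ∧
      (Finset.univ.filter (fun a => src a ∈ X ∧ tgt a ∉ X)).card = k := by
  rcases aux_reach (rsrc src tgt (F : Set A)) (rtgt src tgt (F : Set A)) Set.univ s t with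
    ⟨p, hp, -⟩ | ⟨X, hs, ht, hX⟩
  · left
    refine ⟨symmDiff F p.toFinset, fun f => ?_⟩
    have e := aux_telescopeF _ _ f p s t hp
    have e2 := hF f
    push_cast
    have key : ∀ g : A → ℤ, ∑ a ∈ symmDiff F p.toFinset, g a =
        ∑ a ∈ F, g a + ∑ a ∈ p.toFinset, (if a ∈ F then - g a else g a) := by
      intro g
      rw [← Finset.sum_filter_add_sum_filter_not p.toFinset (fun a => a ∈ F)
        (fun a => if a ∈ F then - g a else g a)]
      rw [Finset.sum_congr (s₁ := p.toFinset.filter (fun a => a ∈ F)) rfl (g := fun a => - g a)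
          (by intro a ha; simp [(Finset.mem_filter.1 ha).2]),
        Finset.sum_congr (s₁ := p.toFinset.filter (fun a => a ∉ F)) rfl (g := g)
          (by intro a ha; simp [(Finset.mem_filter.1 ha).2])]
      rw [← Finset.sum_filter_add_sum_filter_not F (fun a => a ∈ p.toFinset) g]
      have a1 : F.filter (fun a => a ∈ p.toFinset) = p.toFinset.filter (fun a => a ∈ F) := by
        ext a; simp [and_comm]
      have a2 : symmDiff F p.toFinset =
          F.filter (fun a => a ∉ p.toFinset) ∪ p.toFinset.filter (fun a => a ∉ F) := by
        ext a; simp [Finset.mem_symmDiff]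
      rw [a1, a2, Finset.sum_union, Finset.sum_neg_distrib]
      · ring
      · rw [Finset.disjoint_left]
        intro a ha hb
        exact (Finset.mem_filter.1 hb).2 (Finset.mem_filter.1 ha).1
    rw [key, e2]
    have : ∑ a ∈ p.toFinset, (if a ∈ F then - (f (src a) - f (tgt a)) else f (src a) - f (tgt a))
        = f s - f t := by
      rw [← e]
      refine Finset.sum_congr rfl (fun a _ => ?_)
      by_cases h : a ∈ F <;> simp [rsrc, rtgt, h]
    rw [this]; ring
  · right
    refine ⟨X, hs, ht, ?_⟩
    have h := hF (fun x => if x ∈ X then 1 else 0)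
    simp only [hs, ht, if_true, if_false] at h
    have hsub : ∑ a ∈ F, ((if src a ∈ X then (1 : ℤ) else 0) - (if tgt a ∈ X then 1 else 0)) =
        ∑ a, if src a ∈ X ∧ tgt a ∉ X then (1 : ℤ) else 0 := by
      rw [← Finset.sum_subset (Finset.subset_univ F)]
      · refine Finset.sum_congr rfl (fun a ha => ?_)
        have := hX a trivial
        simp only [rsrc, rtgt, Finset.mem_coe, ha, if_true] at this
        split_ifs <;> simp_all
      · intro a _ ha
        have := hX a trivial
        simp only [rsrc, rtgt, Finset.mem_coe, ha, if_false] at this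
        simpa using this
    rw [hsub, Finset.sum_boole] at h
    have : (((Finset.univ.filter (fun a => src a ∈ X ∧ tgt a ∉ X)).card : ℕ) : ℤ) = (k : ℤ) := by
      rw [h]; ring
    exact_mod_cast this

open Classical in
theorem aux_menger {V A : Type*} [Fintype A] (src tgt : A → V) (s t : V) (m : ℕ)
    (h : ∀ X : Set V, s ∈ X → t ∉ X →
      m ≤ (Finset.univ.filter (fun a => src a ∈ X ∧ tgt a ∉ X)).card) :
    (m : ℕ∞) ≤ lambdaConn src tgt s t := by
  have hk : ∀ k ≤ m, ∃ F, AuxFlow src tgt s t F k := by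
    intro k
    induction k with
    | zero => intro _; exact ⟨∅, fun f => by simp⟩
    | succ k ih =>
      intro hk
      obtain ⟨F, hF⟩ := ih (by omega)
      rcases aux_augment src tgt s t k F hF with h1 | ⟨X, hs, ht, hX⟩
      · exact h1
      · have := h X hs ht
        omega
  obtain ⟨F, hF⟩ := hk m le_rfl
  obtain ⟨Ps, h1, -, h3⟩ := aux_decomp src tgt s t m F hF
  exact le_sSup ⟨m, ⟨Ps, h1, h3⟩, rfl⟩

theorem aux_leave {V A : Type*} (src tgt : A → V) (X : Set V) (p : List A) :
    ∀ u v, IsDiwalk src tgt u v p → u ∈ X → v ∉ X → ∃ a ∈ p, src a ∈ X ∧ tgt a ∉ X := by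
  induction p with
  | nil => intro u v h hu hv; exact absurd ((show u = v from h) ▸ hu) hv
  | cons a p ih =>
    intro u v h hu hv
    by_cases ht : tgt a ∈ X
    · obtain ⟨b, hb, hb'⟩ := ih _ _ h.2 ht hv
      exact ⟨b, List.mem_cons_of_mem _ hb, hb'⟩
    · exact ⟨a, by simp, h.1 ▸ hu, ht⟩

open Classical in
theorem aux_cut {V A : Type*} [Fintype A] (src tgt : A → V) (s t : V) (X : Set V)
    (hs : s ∈ X) (ht : t ∉ X) : lambdaConn src tgt s t ≤
      ((Finset.univ.filter (fun a => src a ∈ X ∧ tgt a ∉ X)).card : ℕ∞) := by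
  apply sSup_le
  rintro _ ⟨m, ⟨Ps, h1, h2⟩, rfl⟩
  choose g hg hg' using fun i => aux_leave src tgt X (Ps i) s t (h1 i).1 hs ht
  have : (Finset.univ : Finset (Fin m)).card ≤
      (Finset.univ.filter (fun a => src a ∈ X ∧ tgt a ∉ X)).card := by
    apply Finset.card_le_card_of_injOn g
    · intro i _; simpa using hg' i
    · intro i _ j _ hij
      by_contra hne
      exact h2 hne (hg i) (hij ▸ hg j)
  simpa using this

open Classical in
theorem aux_rev_cut {V A : Type*} [Fintype A] (src tgt : A → V)
    (u v : V) (p : List A) (hp : IsDipath src tgt u v p) (X : Set V) :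
    (((Finset.univ.filter (fun a => rsrc src tgt {a | a ∈ p} a ∈ X ∧
      rtgt src tgt {a | a ∈ p} a ∉ X)).card : ℕ) : ℤ) =
    ((Finset.univ.filter (fun a => src a ∈ X ∧ tgt a ∉ X)).card : ℕ) -
      ((if u ∈ X then 1 else 0) - (if v ∈ X then 1 else 0)) := by
  rw [← aux_telescopeF src tgt (fun x => if x ∈ X then 1 else 0) p u v hp]
  rw [← Finset.sum_boole, ← Finset.sum_boole]
  have : ∑ a ∈ p.toFinset, ((if src a ∈ X then (1 : ℤ) else 0) - (if tgt a ∈ X then 1 else 0)) =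
    ∑ a, if a ∈ p.toFinset then
      ((if src a ∈ X then (1 : ℤ) else 0) - (if tgt a ∈ X then 1 else 0)) else 0 := by
    simp only [Finset.sum_ite_mem, Finset.univ_inter]
  rw [this, ← Finset.sum_sub_distrib]
  refine Finset.sum_congr rfl (fun a _ => ?_)
  by_cases h : a ∈ p <;> by_cases h1 : src a ∈ X <;> by_cases h2 : tgt a ∈ X <;>
    simp [rsrc, rtgt, h, h1, h2]

end Helpers

/-- Reversing a directed path from `u` to `v`, for all vertices
`u', v'` one has `λ_{D^P}(u',v') ≥ min (λ_D(u,v) - 1) (λ_D(u',v'))`. -/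
theorem stmt_5 {V A : Type*} [Fintype V] [Fintype A]
    (src tgt : A → V) (hloop : ∀ a, src a ≠ tgt a)
    (u v : V) (p : List A) (hp : IsDipath src tgt u v p) (u' v' : V) :
    min (lambdaConn src tgt u v - 1) (lambdaConn src tgt u' v') ≤
      lambdaConn (rsrc src tgt {a | a ∈ p}) (rtgt src tgt {a | a ∈ p}) u' v' := by
  classical
  refine ENat.forall_natCast_le_iff_le.1 (fun m hm => ?_)
  obtain ⟨hm1, hm2⟩ := le_min_iff.1 hm
  apply aux_menger
  intro X hs ht
  rcases Nat.eq_zero_or_pos m with rfl | hpos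
  · exact Nat.zero_le _
  have e := aux_rev_cut src tgt u v p hp X
  have c2 : m ≤ (Finset.univ.filter (fun a => src a ∈ X ∧ tgt a ∉ X)).card := by
    exact_mod_cast hm2.trans (aux_cut src tgt u' v' X hs ht)
  by_cases hu : u ∈ X
  · by_cases hv : v ∈ X
    · simp only [hu, hv, if_true] at e
      omega
    · have c1 : (m : ℕ∞) ≤
          ((Finset.univ.filter (fun a => src a ∈ X ∧ tgt a ∉ X)).card : ℕ∞) - 1 :=
        hm1.trans (tsub_le_tsub_right (aux_cut src tgt u v X hu hv) 1)
      have c1' : m ≤ (Finset.univ.filter (fun a => src a ∈ X ∧ tgt a ∉ X)).card - 1 := by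
        exact_mod_cast c1
      simp only [hu, hv, if_true, if_false] at e
      omega
  · by_cases hv : v ∈ X <;> simp only [hu, hv, if_true, if_false] at e <;> omega
end

section
/- Let D be a finite digraph and let P_{uv} be a directed path from a vertex u to a vertex v in D. Then λ_{D^{P_{uv}}}(u,v) = λ_D(u,v) − 1, i.e., reversing a directed path from u to v decreases the maximum number of pairwise arc-disjoint directed paths from u to v by exactly one. -/
open Classical in
/-- Contribution of an arc at a vertex. -/
noncomputable def arcNet {V A : Type*} (src tgt : A → V) (w : V) (a : A) : ℤ :=
  (if src a = w then 1 else 0) - (if tgt a = w then 1 else 0)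

open Classical in
/-- `F` is a `0/1`-flow of value `m` from `u` to `v`. -/
def IsArcFlow {V A : Type*} (src tgt : A → V) (u v : V) (F : Finset A) (m : ℕ) : Prop :=
  ∀ w, ∑ a ∈ F, arcNet src tgt w a =
    m * ((if u = w then 1 else 0) - (if v = w then 1 else 0))

open Classical in
theorem walk_net {V A : Type*} (src tgt : A → V) (w v : V) (p : List A) :
    ∀ u, IsDiwalk src tgt u v p →
    (p.map (arcNet src tgt w)).sum = (if u = w then 1 else 0) - (if v = w then 1 else 0) := by
  induction p with
  | nil => intro u h; simp only [IsDiwalk] at h; subst h; simp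
  | cons a p ih =>
    intro u h
    simp only [IsDiwalk] at h
    obtain ⟨rfl, h⟩ := h
    rw [List.map_cons, List.sum_cons, ih _ h]
    unfold arcNet
    ring

open Classical in
theorem path_flow {V A : Type*} (src tgt : A → V) (u v : V) (p : List A)
    (hp : IsDipath src tgt u v p) (w : V) :
    ∑ a ∈ p.toFinset, arcNet src tgt w a =
      (if u = w then 1 else 0) - (if v = w then 1 else 0) := by
  have hn : p.Nodup := List.Nodup.of_map _ (List.nodup_cons.1 hp.2).2
  rw [List.sum_toFinset _ hn, walk_net src tgt w v p u hp.1]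

open Classical in
theorem paths_to_flow {V A : Type*} (src tgt : A → V) (u v : V) (m : ℕ)
    (Ps : Fin m → List A) (h1 : ∀ i, IsDipath src tgt u v (Ps i))
    (h2 : Pairwise fun i j => (Ps i).Disjoint (Ps j)) :
    ∃ F : Finset A, IsArcFlow src tgt u v F m := by
  refine ⟨Finset.univ.biUnion fun i => (Ps i).toFinset, fun w => ?_⟩
  rw [Finset.sum_biUnion]
  · rw [Finset.sum_congr rfl fun i _ => path_flow src tgt u v (Ps i) (h1 i) w]
    simp [mul_sub]
  · intro i _ j _ hij
    have := h2 hij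
    simp only [Function.onFun]
    rw [Finset.disjoint_left]
    intro a ha hb
    exact this (List.mem_toFinset.1 ha) (List.mem_toFinset.1 hb)

theorem path_suffix {V A : Type*} (src tgt : A → V) (v x : V) (q : List A) :
    ∀ y, IsDipath src tgt y v q → x ∈ y :: q.map tgt →
      ∃ q', q' ⊆ q ∧ IsDipath src tgt x v q' := by
  induction q with
  | nil =>
    intro y h hx
    simp at hx
    subst hx
    exact ⟨[], by simp, h⟩
  | cons a q ih =>
    intro y h hx
    by_cases hxy : x = y
    · subst hxy; exact ⟨_, fun _ h => h, h⟩
    · have hx' : x ∈ tgt a :: q.map tgt := by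
        simpa [hxy] using hx
      obtain ⟨hw, hn⟩ := h
      obtain ⟨q', hs, hq'⟩ := ih (tgt a) ⟨hw.2, (List.nodup_cons.1 hn).2⟩ hx'
      exact ⟨q', fun z hz => List.mem_cons_of_mem _ (hs hz), hq'⟩

theorem reach_path {V A : Type*} (src tgt : A → V) (F : Finset A) (u v : V)
    (h : Relation.ReflTransGen (fun x y => ∃ a ∈ F, src a = x ∧ tgt a = y) u v) :
    ∃ q : List A, (∀ a ∈ q, a ∈ F) ∧ IsDipath src tgt u v q := by
  induction h using Relation.ReflTransGen.head_induction_on with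
  | refl => exact ⟨[], by simp, rfl, by simp⟩
  | head h1 _ ih =>
    rename_i x y _
    obtain ⟨a, haF, rfl, rfl⟩ := h1
    obtain ⟨q, hqF, hq⟩ := ih
    by_cases hx : src a ∈ tgt a :: q.map tgt
    · obtain ⟨q', hs, hq'⟩ := path_suffix src tgt v _ q _ hq hx
      exact ⟨q', fun b hb => hqF b (hs hb), hq'⟩
    · refine ⟨a :: q, ?_, ⟨rfl, hq.1⟩, ?_⟩
      · intro b hb
        rcases List.mem_cons.1 hb with rfl | hb
        · exact haF
        · exact hqF b hb
      · exact List.nodup_cons.2 ⟨hx, hq.2⟩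

open Classical in
theorem flow_reach {V A : Type*} [Fintype V] (src tgt : A → V) (F : Finset A) (u v : V)
    (m : ℕ) (hF : IsArcFlow src tgt u v F (m + 1)) :
    Relation.ReflTransGen (fun x y => ∃ a ∈ F, src a = x ∧ tgt a = y) u v := by
  by_contra hv
  set X : Finset V := Finset.univ.filter fun x =>
    Relation.ReflTransGen (fun x y => ∃ a ∈ F, src a = x ∧ tgt a = y) u x with hX
  have huX : u ∈ X := by simp [hX, Relation.ReflTransGen.refl]
  have hvX : v ∉ X := by simpa [hX] using hv
  have e1 : ∑ w ∈ X, ∑ a ∈ F, arcNet src tgt w a = m + 1 := by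
    rw [Finset.sum_congr rfl fun w _ => hF w, ← Finset.mul_sum, Finset.sum_sub_distrib,
      Finset.sum_ite_eq, Finset.sum_ite_eq, if_pos huX, if_neg hvX]
    simp
  have e2 : ∑ w ∈ X, ∑ a ∈ F, arcNet src tgt w a ≤ 0 := by
    rw [Finset.sum_comm]
    apply Finset.sum_nonpos
    intro a ha
    unfold arcNet
    rw [Finset.sum_sub_distrib, Finset.sum_ite_eq, Finset.sum_ite_eq]
    by_cases hs : src a ∈ X
    · have ht : tgt a ∈ X := by
        simp only [hX, Finset.mem_filter, Finset.mem_univ, true_and] at hs ⊢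
        exact hs.tail ⟨a, ha, rfl, rfl⟩
      simp [hs, ht]
    · rw [if_neg hs]; split_ifs <;> simp
  omega

open Classical in
theorem flow_to_paths {V A : Type*} [Fintype V] (src tgt : A → V) (u v : V) (m : ℕ) :
    ∀ F : Finset A, IsArcFlow src tgt u v F m →
      ∃ Ps : Fin m → List A, (∀ i, ∀ a ∈ Ps i, a ∈ F) ∧ (∀ i, IsDipath src tgt u v (Ps i)) ∧
        Pairwise fun i j => (Ps i).Disjoint (Ps j) := by
  induction m with
  | zero => intro F _; exact ⟨fun _ => [], fun i => i.elim0, fun i => i.elim0, fun i => i.elim0⟩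
  | succ m ih =>
    intro F hF
    obtain ⟨q, hqF, hq⟩ := reach_path src tgt F u v (flow_reach src tgt F u v m hF)
    have hsub : q.toFinset ⊆ F := fun a ha => hqF a (List.mem_toFinset.1 ha)
    obtain ⟨Ps, h0, h1, h2⟩ := ih (F \ q.toFinset) (by
      intro w
      have e1 := Finset.sum_sdiff (f := arcNet src tgt w) hsub
      rw [hF w, path_flow src tgt u v q hq w] at e1
      push_cast at e1
      linarith)
    have hd : ∀ i, ∀ a ∈ Ps i, a ∉ q := by
      intro i a ha hb
      have := h0 i a ha
      simp [hb] at this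
    refine ⟨Fin.cons q Ps, ?_, ?_, ?_⟩
    · intro i
      refine Fin.cases ?_ (fun i => ?_) i
      · simpa using hqF
      · intro a ha
        exact (Finset.mem_sdiff.1 (h0 i a (by simpa using ha))).1
    · intro i
      refine Fin.cases ?_ (fun i => ?_) i
      · simpa using hq
      · simpa using h1 i
    · intro i j
      refine Fin.cases ?_ (fun i => ?_) i <;> refine Fin.cases ?_ (fun j => ?_) j
      · intro h; exact absurd rfl h
      · intro _ a ha hb
        exact hd j a (by simpa using hb) (by simpa using ha)
      · intro _ a ha hb
        exact hd i a (by simpa using ha) (by simpa using hb)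
      · intro hij
        have := h2 (i := i) (j := j) (fun h => hij (by rw [h]))
        simpa using this

open Classical in
theorem rev_net {V A : Type*} [Fintype A] (src tgt : A → V) (p : List A) (F : Finset A) (w : V) :
    ∑ a ∈ symmDiff F p.toFinset,
        arcNet (rsrc src tgt {a | a ∈ p}) (rtgt src tgt {a | a ∈ p}) w a =
      ∑ a ∈ F, arcNet src tgt w a - ∑ a ∈ p.toFinset, arcNet src tgt w a := by
  have key : ∀ (G : Finset A) (f : A → ℤ), ∑ a ∈ G, f a = ∑ a, if a ∈ G then f a else 0 := by
    intro G f
    simp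
  rw [key, key F, key p.toFinset, ← Finset.sum_sub_distrib]
  apply Finset.sum_congr rfl
  intro a _
  by_cases h1 : a ∈ F <;> by_cases h2 : a ∈ p <;>
    simp [Finset.mem_symmDiff, arcNet, rsrc, rtgt, h1, h2]

theorem count_iff {V A : Type*} [Fintype V] [Fintype A]
    (src tgt : A → V) (u v : V) (p : List A) (hp : IsDipath src tgt u v p) (m : ℕ) :
    (∃ Ps : Fin m → List A,
      (∀ i, IsDipath (rsrc src tgt {a | a ∈ p}) (rtgt src tgt {a | a ∈ p}) u v (Ps i)) ∧
      Pairwise fun i j => (Ps i).Disjoint (Ps j)) ↔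
    (∃ Ps : Fin (m + 1) → List A, (∀ i, IsDipath src tgt u v (Ps i)) ∧
      Pairwise fun i j => (Ps i).Disjoint (Ps j)) := by
  classical
  constructor
  · rintro ⟨Ps, h1, h2⟩
    obtain ⟨F, hF⟩ := paths_to_flow _ _ u v m Ps h1 h2
    obtain ⟨Qs, -, h⟩ := flow_to_paths src tgt u v (m + 1) (symmDiff F p.toFinset) (by
      intro w
      have e := rev_net src tgt p (symmDiff F p.toFinset) w
      rw [symmDiff_symmDiff_cancel_right, hF w, path_flow src tgt u v p hp w] at e
      push_cast
      linarith)
    exact ⟨Qs, h⟩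
  · rintro ⟨Ps, h1, h2⟩
    obtain ⟨F, hF⟩ := paths_to_flow _ _ u v (m + 1) Ps h1 h2
    obtain ⟨Qs, -, h⟩ := flow_to_paths (rsrc src tgt {a | a ∈ p}) (rtgt src tgt {a | a ∈ p})
      u v m (symmDiff F p.toFinset) (by
      intro w
      rw [rev_net src tgt p F w, hF w, path_flow src tgt u v p hp w]
      push_cast
      ring)
    exact ⟨Qs, h⟩


/-- Reversing a directed path from `u` to `v` decreases the maximum
number of pairwise arc-disjoint directed paths from `u` to `v` by exactly one. -/
theorem stmt_6 {V A : Type*} [Fintype V] [Fintype A]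
    (src tgt : A → V) (hloop : ∀ a, src a ≠ tgt a)
    (u v : V) (p : List A) (hp : IsDipath src tgt u v p) :
    lambdaConn (rsrc src tgt {a | a ∈ p}) (rtgt src tgt {a | a ∈ p}) u v =
      lambdaConn src tgt u v - 1 := by

  have hc := count_iff src tgt u v p hp
  unfold lambdaConn
  apply le_antisymm
  · apply sSup_le
    rintro _ ⟨m, hm, rfl⟩
    have h := (hc m).1 hm
    apply ENat.le_sub_of_add_le_right (by simp)
    apply le_sSup
    exact ⟨m + 1, h, by simp⟩
  · rw [tsub_le_iff_right]
    apply sSup_le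
    rintro _ ⟨m, hm, rfl⟩
    cases m with
    | zero => simp
    | succ m =>
      have h := (hc m).2 hm
      simp only [Nat.cast_add, Nat.cast_one]
      gcongr
      apply le_sSup
      exact ⟨m, h, rfl⟩
end

section
/- Let G = (V,E) be a finite loopless multigraph and let D, D' be two k-arc-connected orientations of G. For every vertex v with δ⁺_D(v) > δ⁺_{D'}(v), there exists a vertex u with δ⁺_D(u) < δ⁺_{D'}(u) such that λ_D(v,u) > k, i.e., the pair (v,u) is flippable in D (reversing any directed path from v to u in D yields a k-arc-connected orientation). -/
section Helpers
open Classical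

lemma diwalk_sum {V A : Type*} (s t : A → V) (φ : V → ℤ) (p : List A) :
    ∀ u v, IsDiwalk s t u v p → (p.map (fun a => φ (s a) - φ (t a))).sum = φ u - φ v := by
  induction p with
  | nil => intro u v h; simp only [IsDiwalk] at h; simp [h]
  | cons a p ih =>
    intro u v h
    simp only [IsDiwalk] at h
    obtain ⟨h1, h2⟩ := h
    rw [List.map_cons, List.sum_cons, ih _ _ h2, h1]; ring

lemma dipath_suffix {V A : Type*} (s t : A → V) (G : Set A) (u y : V) (p : List A) :
    ∀ x, IsDipath s t x u p → (∀ a ∈ p, a ∈ G) → y ∈ x :: p.map t →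
      ∃ q, IsDipath s t y u q ∧ ∀ a ∈ q, a ∈ G := by
  induction p with
  | nil =>
    intro x h hG hy
    simp only [List.map_nil, List.mem_singleton] at hy
    subst hy
    exact ⟨_, h, hG⟩
  | cons a p ih =>
    intro x h hG hy
    rcases List.mem_cons.1 hy with rfl | hy
    · exact ⟨_, h, hG⟩
    · refine ih (t a) ⟨h.1.2, ?_⟩ (fun b hb => hG b (List.mem_cons_of_mem _ hb)) ?_
      · have := h.2
        rw [List.map_cons] at this
        exact (List.nodup_cons.1 this).2
      · simpa using hy

lemma path_or_cut {V A : Type*} (s t : A → V) (G : Set A) (v u : V) :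
    (∃ p, IsDipath s t v u p ∧ ∀ a ∈ p, a ∈ G) ∨
    ∃ X : Set V, v ∈ X ∧ u ∉ X ∧ ∀ a ∈ G, s a ∈ X → t a ∈ X := by
  by_cases h : ∃ p, IsDipath s t v u p ∧ ∀ a ∈ p, a ∈ G
  · exact Or.inl h
  right
  refine ⟨{x | ¬ ∃ p, IsDipath s t x u p ∧ ∀ a ∈ p, a ∈ G}, h, ?_, ?_⟩
  · simp only [Set.mem_setOf_eq, not_not]
    exact ⟨[], ⟨rfl, by simp⟩, by simp⟩
  · intro a ha hs ht
    apply hs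
    obtain ⟨p, hp, hG⟩ := ht
    by_cases hm : s a ∈ t a :: p.map t
    · exact dipath_suffix s t G u _ p _ hp hG hm
    · refine ⟨a :: p, ⟨⟨rfl, hp.1⟩, ?_⟩, ?_⟩
      · rw [List.map_cons]; exact List.nodup_cons.2 ⟨hm, hp.2⟩
      · intro b hb
        rcases List.mem_cons.1 hb with rfl | hb
        · exact ha
        · exact hG b hb

/-- `F` is (the support of) an integral unit-capacity flow of value `m` from `v` to `u`. -/
def IsFlow {V A : Type*} (s t : A → V) (v u : V) (m : ℕ) (F : Finset A) : Prop :=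
  ∀ φ : V → ℤ, ∑ a ∈ F, (φ (s a) - φ (t a)) = m * (φ v - φ u)

lemma sum_toFinset_path {V A : Type*} (s t : A → V) (v u : V) (p : List A)
    (hp : IsDipath s t v u p) (φ : V → ℤ) :
    ∑ a ∈ p.toFinset, (φ (s a) - φ (t a)) = φ v - φ u := by
  have hn : p.Nodup := List.Nodup.of_map t (List.nodup_cons.1 hp.2).2
  rw [List.sum_toFinset _ hn, diwalk_sum s t φ p v u hp.1]

lemma flow_decomp {V A : Type*} (s t : A → V) (v u : V) (m : ℕ) :
    ∀ F : Finset A, IsFlow s t v u m F → ∃ Ps : Fin m → List A,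
      (∀ i, IsDipath s t v u (Ps i)) ∧ (Pairwise fun i j => (Ps i).Disjoint (Ps j)) ∧
      ∀ i, ∀ a ∈ Ps i, a ∈ F := by
  induction m with
  | zero => intro F _; exact ⟨fun i => i.elim0, fun i => i.elim0, fun i => i.elim0, fun i => i.elim0⟩
  | succ m ih =>
    intro F hF
    rcases path_or_cut s t (↑F) v u with ⟨p, hp, hpF⟩ | ⟨X, hv, hu, hX⟩
    · have hsub : p.toFinset ⊆ F := by
        intro a ha; exact hpF a (List.mem_toFinset.1 ha)
      obtain ⟨Ps, h1, h2, h3⟩ := ih (F \ p.toFinset) (by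
        intro φ
        have e1 := Finset.sum_sdiff (f := fun a => φ (s a) - φ (t a)) hsub
        have e2 := hF φ
        have e3 := sum_toFinset_path s t v u p hp φ
        push_cast at e2
        linarith)
      have hd : ∀ i, ∀ a ∈ Ps i, a ∉ p := by
        intro i a ha hap
        have := h3 i a ha
        simp [hap] at this
      refine ⟨Fin.cons p Ps, ?_, ?_, ?_⟩
      · intro i
        refine Fin.cases ?_ ?_ i
        · simpa using hp
        · intro i; simpa using h1 i
      · intro i j
        refine Fin.cases ?_ ?_ i <;> refine Fin.cases ?_ ?_ j
        · intro h; exact absurd rfl h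
        · intro j _ a ha hb
          simp only [Fin.cons_zero, Fin.cons_succ] at ha hb
          exact hd j a hb ha
        · intro j _ a ha hb
          simp only [Fin.cons_zero, Fin.cons_succ] at ha hb
          exact hd j a ha hb
        · intro j i hij
          simp only [Fin.cons_succ]
          exact h2 (fun h => hij (by rw [h]))
      · intro i
        refine Fin.cases ?_ ?_ i
        · simpa using hpF
        · intro i a ha
          simp only [Fin.cons_succ] at ha
          exact (Finset.mem_sdiff.1 (h3 i a ha)).1
    · exfalso
      have e := hF (fun x => if x ∈ X then 1 else 0)
      have : ∑ a ∈ F, ((if s a ∈ X then (1:ℤ) else 0) - (if t a ∈ X then 1 else 0)) ≤ 0 := by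
        apply Finset.sum_nonpos
        intro a ha
        have := hX a ha
        split_ifs <;> simp_all
      simp only [hv, hu, if_true, if_false] at e
      push_cast at e
      linarith

lemma outdegS_eq_s9 {V A : Type*} [Fintype A] (s t : A → V) (X : Set V) :
    (outdegS s t X : ℤ) = ∑ a, if s a ∈ X ∧ t a ∉ X then (1:ℤ) else 0 := by
  unfold outdegS
  rw [Nat.card_eq_fintype_card, Fintype.card_subtype]
  simp

lemma outdegV_eq {V A : Type*} [Fintype A] (s t : A → V) (w : V) :
    (outdegV s t w : ℤ) = ∑ a, if s a = w then (1:ℤ) else 0 := by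
  unfold outdegV
  rw [Nat.card_eq_fintype_card, Fintype.card_subtype]
  simp

lemma flow_exists {V A : Type*} [Fintype A] (s t : A → V) (v u : V) (m : ℕ)
    (hcut : ∀ X : Set V, v ∈ X → u ∉ X → m ≤ outdegS s t X) :
    ∀ j ≤ m, ∃ F : Finset A, IsFlow s t v u j F := by
  intro j
  induction j with
  | zero => intro _; exact ⟨∅, fun φ => by simp⟩
  | succ j ih =>
    intro hj
    obtain ⟨F, hF⟩ := ih (by omega)
    let s' : A → V := fun a => if a ∈ F then t a else s a
    let t' : A → V := fun a => if a ∈ F then s a else t a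
    rcases path_or_cut s' t' Set.univ v u with ⟨p, hp, -⟩ | ⟨X, hv, hu, hX⟩
    · refine ⟨symmDiff F p.toFinset, fun φ => ?_⟩
      have e1 := hF φ
      have e2 := sum_toFinset_path s' t' v u p hp φ
      have e3 : ∑ a ∈ symmDiff F p.toFinset, (φ (s a) - φ (t a)) =
          ∑ a ∈ F, (φ (s a) - φ (t a)) + ∑ a ∈ p.toFinset, (φ (s' a) - φ (t' a)) := by
        rw [← Finset.sum_filter_add_sum_filter_not p.toFinset (fun a => a ∈ F),
          ← Finset.sum_filter_add_sum_filter_not F (fun a => a ∈ p.toFinset),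
          ← Finset.sum_filter_add_sum_filter_not (symmDiff F p.toFinset) (fun a => a ∈ F)]
        have a1 : (symmDiff F p.toFinset).filter (fun a => a ∈ F) =
            F.filter (fun a => a ∉ p.toFinset) := by
          ext a; simp only [Finset.mem_filter, Finset.mem_symmDiff]; tauto
        have a2 : (symmDiff F p.toFinset).filter (fun a => a ∉ F) =
            p.toFinset.filter (fun a => a ∉ F) := by
          ext a; simp only [Finset.mem_filter, Finset.mem_symmDiff]; tauto
        have a3 : F.filter (fun a => a ∈ p.toFinset) = p.toFinset.filter (fun a => a ∈ F) := by
          ext a; simp only [Finset.mem_filter]; tauto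
        have b1 : ∑ a ∈ p.toFinset.filter (fun a => a ∈ F), (φ (s' a) - φ (t' a)) =
            - ∑ a ∈ p.toFinset.filter (fun a => a ∈ F), (φ (s a) - φ (t a)) := by
          rw [← Finset.sum_neg_distrib]
          apply Finset.sum_congr rfl
          intro a ha
          have := (Finset.mem_filter.1 ha).2
          simp [s', t', this]
        have b2 : ∑ a ∈ p.toFinset.filter (fun a => a ∉ F), (φ (s' a) - φ (t' a)) =
            ∑ a ∈ p.toFinset.filter (fun a => a ∉ F), (φ (s a) - φ (t a)) := by
          apply Finset.sum_congr rfl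
          intro a ha
          have := (Finset.mem_filter.1 ha).2
          simp [s', t', this]
        rw [a1, a2, a3, b1, b2]; ring
      rw [e3, e1, e2]; push_cast; ring
    · exfalso
      have e := hF (fun x => if x ∈ X then 1 else 0)
      have h1 := outdegS_eq_s9 s t X
      have h2 : (∑ a, if s a ∈ X ∧ t a ∉ X then (1:ℤ) else 0) =
          ∑ a ∈ F, ((if s a ∈ X then (1:ℤ) else 0) - (if t a ∈ X then 1 else 0)) := by
        rw [← Finset.sum_filter_add_sum_filter_not Finset.univ (fun a => a ∈ F)]
        have : (Finset.univ.filter (fun a => a ∈ F)) = F := by ext; simp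
        rw [this]
        have z : ∑ a ∈ Finset.univ.filter (fun a => a ∉ F),
            (if s a ∈ X ∧ t a ∉ X then (1:ℤ) else 0) = 0 := by
          apply Finset.sum_eq_zero
          intro a ha
          have h := hX a trivial
          simp only [Finset.mem_filter, Finset.mem_univ, true_and] at ha
          simp only [s', t', ha, if_false] at h
          rw [if_neg]; tauto
        rw [z, add_zero]
        apply Finset.sum_congr rfl
        intro a ha
        have h := hX a trivial
        simp only [s', t', ha, if_true] at h
        by_cases c1 : s a ∈ X <;> by_cases c2 : t a ∈ X <;> simp_all
      simp only [hv, hu, if_true, if_false] at e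
      have := hcut X hv hu
      have : ((j:ℤ) + 1) ≤ outdegS s t X := by exact_mod_cast hj.trans this
      rw [h1, h2, e] at this
      linarith

lemma lambda_ge {V A : Type*} [Fintype A] (s t : A → V) (v u : V) (m : ℕ)
    (hcut : ∀ X : Set V, v ∈ X → u ∉ X → m ≤ outdegS s t X) :
    (m : ℕ∞) ≤ lambdaConn s t v u := by
  obtain ⟨F, hF⟩ := flow_exists s t v u m hcut m le_rfl
  obtain ⟨Ps, h1, h2, -⟩ := flow_decomp s t v u m F hF
  exact le_sSup ⟨m, ⟨Ps, h1, h2⟩, rfl⟩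

lemma outdegS_submod {V A : Type*} [Fintype A] (s t : A → V) (X Y : Set V) :
    outdegS s t (X ∩ Y) + outdegS s t (X ∪ Y) ≤ outdegS s t X + outdegS s t Y := by
  zify
  simp only [outdegS_eq_s9, ← Finset.sum_add_distrib]
  apply Finset.sum_le_sum
  intro a _
  by_cases c1 : s a ∈ X <;> by_cases c2 : t a ∈ X <;> by_cases c3 : s a ∈ Y <;>
    by_cases c4 : t a ∈ Y <;> simp [c1, c2, c3, c4]

lemma sum_outdegV {V A : Type*} [Fintype A] (s t : A → V) (Z : Finset V) :
    ∑ w ∈ Z, (outdegV s t w : ℤ) =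
      (∑ a, if s a ∈ Z ∨ t a ∈ Z then (1:ℤ) else 0) - outdegS s t ((↑Z : Set V)ᶜ) := by
  simp only [outdegV_eq, outdegS_eq_s9]
  rw [Finset.sum_comm, ← Finset.sum_sub_distrib]
  apply Finset.sum_congr rfl
  intro a _
  by_cases c1 : s a ∈ Z <;> by_cases c2 : t a ∈ Z <;> simp [c1, c2]

end Helpers

/-- For two `k`-arc-connected orientations `D, D'` of a finite loopless
multigraph and a vertex `v` with `δ⁺_D(v) > δ⁺_{D'}(v)`, there is a vertex `u` with
`δ⁺_D(u) < δ⁺_{D'}(u)` such that `λ_D(v,u) > k`, i.e. `(v,u)` is flippable in `D`. -/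
theorem stmt_9 {V E : Type*} [Fintype V] [Fintype E]
    (ends : E → Sym2 V) (hloop : ∀ e, ¬ (ends e).IsDiag) (k : ℕ)
    (D D' : GraphOrientation V E ends)
    (hD : IsKConnected D.src D.tgt k) (hD' : IsKConnected D'.src D'.tgt k)
    (v : V) (hv : outdegV D'.src D'.tgt v < outdegV D.src D.tgt v) :
    ∃ u : V, outdegV D.src D.tgt u < outdegV D'.src D'.tgt u ∧
      (k : ℕ∞) < lambdaConn D.src D.tgt v u := by
  classical
  by_contra hcon
  push Not at hcon
  have hinc : ∀ Z : Finset V, (∑ a, if D.src a ∈ Z ∨ D.tgt a ∈ Z then (1:ℤ) else 0) =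
      ∑ a, if D'.src a ∈ Z ∨ D'.tgt a ∈ Z then (1:ℤ) else 0 := by
    intro Z
    apply Finset.sum_congr rfl
    intro a _
    have h := (D.compat a).trans (D'.compat a).symm
    rcases Sym2.eq_iff.1 h with ⟨h1, h2⟩ | ⟨h1, h2⟩
    · rw [h1, h2]
    · rw [h1, h2]; simp only [or_comm]
  let f : V → ℤ := fun w => (outdegV D'.src D'.tgt w : ℤ) - outdegV D.src D.tgt w
  have hf : ∀ Z : Finset V, ∑ w ∈ Z, f w =
      outdegS D.src D.tgt ((↑Z : Set V)ᶜ) - outdegS D'.src D'.tgt ((↑Z : Set V)ᶜ) := by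
    intro Z
    simp only [f]
    rw [Finset.sum_sub_distrib, sum_outdegV, sum_outdegV, hinc]; ring
  let T : Finset V → Prop := fun Z => v ∉ Z ∧ Z.Nonempty ∧ outdegS D.src D.tgt ((↑Z : Set V)ᶜ) = k
  have hne : ∀ Z : Finset V, v ∉ Z → Z.Nonempty →
      ((↑Z : Set V)ᶜ).Nonempty ∧ ((↑Z : Set V)ᶜ) ≠ Set.univ := by
    intro Z h1 h2
    refine ⟨⟨v, by simpa using h1⟩, ?_⟩
    obtain ⟨w, hw⟩ := h2
    intro h
    have : w ∈ ((↑Z : Set V)ᶜ) := h ▸ trivial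
    exact this hw
  have hTf : ∀ Z, T Z → ∑ w ∈ Z, f w ≤ 0 := by
    rintro Z ⟨h1, h2, h3⟩
    have := hD' _ (hne Z h1 h2).1 (hne Z h1 h2).2
    rw [hf, h3]
    have : (k:ℤ) ≤ outdegS D'.src D'.tgt ((↑Z : Set V)ᶜ) := by exact_mod_cast this
    linarith
  have hTu : ∀ Z Y, T Z → T Y → (Z ∩ Y).Nonempty → T (Z ∪ Y) := by
    rintro Z Y ⟨h1, h2, h3⟩ ⟨g1, g2, g3⟩ hi
    have hv1 : v ∉ Z ∪ Y := by simp [h1, g1]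
    have hv2 : v ∉ Z ∩ Y := by simp [h1]
    have hn : (Z ∪ Y).Nonempty := h2.mono Finset.subset_union_left
    refine ⟨hv1, hn, ?_⟩
    have a1 := hD _ (hne _ hv1 hn).1 (hne _ hv1 hn).2
    have a2 := hD _ (hne _ hv2 hi).1 (hne _ hv2 hi).2
    have a3 := outdegS_submod D.src D.tgt ((↑Z : Set V)ᶜ) ((↑Y : Set V)ᶜ)
    rw [← Set.compl_union, ← Set.compl_inter, ← Finset.coe_union, ← Finset.coe_inter] at a3
    omega
  have hcov : ∀ u, 0 < f u → ∃ Z, Maximal T Z ∧ u ∈ Z := by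
    intro u hu
    have hu' : outdegV D.src D.tgt u < outdegV D'.src D'.tgt u := by
      simp only [f] at hu; omega
    have hl := hcon u hu'
    have : ¬ ∀ X : Set V, v ∈ X → u ∉ X → k + 1 ≤ outdegS D.src D.tgt X := by
      intro h
      have := (lambda_ge D.src D.tgt v u (k+1) h).trans hl
      have : k + 1 ≤ k := by exact_mod_cast this
      omega
    push Not at this
    obtain ⟨X, hvX, huX, hX⟩ := this
    have hX2 := hD X ⟨v, hvX⟩ (fun h => huX (h ▸ trivial))
    have hT : T (Xᶜ).toFinset := by
      refine ⟨by simpa using hvX, ⟨u, by simpa using huX⟩, ?_⟩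
      rw [Set.coe_toFinset, compl_compl]; omega
    obtain ⟨Z, hZ, hm⟩ := Set.Finite.exists_le_maximal (Set.toFinite {Z | T Z}) hT
    exact ⟨Z, hm, hZ (by simpa using huX)⟩
  let M : Finset (Finset V) := Finset.univ.filter (fun Z => Maximal T Z)
  have hdis : (↑M : Set (Finset V)).PairwiseDisjoint id := by
    intro Z hZ Y hY hne'
    have hZ' : Maximal T Z := by simpa [M] using hZ
    have hY' : Maximal T Y := by simpa [M] using hY
    simp only [Function.onFun, id]
    by_contra hd
    rw [Finset.disjoint_iff_inter_eq_empty, ← Ne, ← Finset.nonempty_iff_ne_empty] at hd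
    have hU := hTu Z Y hZ'.1 hY'.1 hd
    have q1 := hZ'.eq_of_le hU Finset.subset_union_left
    have q2 := hY'.eq_of_le hU Finset.subset_union_right
    exact hne' (q1.trans q2.symm)
  have s1 : ∑ w ∈ M.biUnion id, f w ≤ 0 := by
    rw [Finset.sum_biUnion hdis]
    apply Finset.sum_nonpos
    intro Z hZ
    exact hTf Z (Finset.mem_filter.1 hZ).2.1
  have s2 : ∑ w ∈ (M.biUnion id)ᶜ, f w < 0 := by
    apply Finset.sum_neg'
    · intro w hw
      by_contra h
      obtain ⟨Z, hZ, hwZ⟩ := hcov w (not_le.1 h)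
      apply Finset.mem_compl.1 hw
      exact Finset.mem_biUnion.2 ⟨Z, by simpa [M] using hZ, hwZ⟩
    · refine ⟨v, ?_, ?_⟩
      · rw [Finset.mem_compl, Finset.mem_biUnion]
        rintro ⟨Z, hZ, hvZ⟩
        exact (Finset.mem_filter.1 hZ).2.1.1 hvZ
      · simp only [f]; omega
  have s3 := Finset.sum_add_sum_compl (M.biUnion id) f
  have s4 : ∑ w, f w = 0 := by
    rw [hf]
    simp [outdegS]
  linarith
end

section
/- Let k ≥ 1 and let D be a k-arc-connected finite digraph with n ≥ 2 vertices. Then D contains at least (k−1)·n + 1 distinct directed cycles. -/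
theorem diwalk_append {V A : Type*} (src tgt : A → V) (p q : List A) (u w : V) :
    IsDiwalk src tgt u w (p ++ q) ↔ ∃ v, IsDiwalk src tgt u v p ∧ IsDiwalk src tgt v w q := by
  induction p generalizing u with
  | nil => simp [IsDiwalk]
  | cons a p ih => simp [IsDiwalk, ih, and_assoc]

theorem exists_dup {V A : Type*} (f : A → V) (p : List A) (h : ¬ (p.map f).Nodup) :
    ∃ l1 a l2 b l3, p = l1 ++ a :: (l2 ++ b :: l3) ∧ f a = f b := by
  induction p with
  | nil => simp at h
  | cons a p ih =>
    by_cases hp : (p.map f).Nodup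
    · have : f a ∈ p.map f := by
        by_contra hc
        exact h (by rw [List.map_cons]; exact List.nodup_cons.2 ⟨hc, hp⟩)
      obtain ⟨b, hb, hab⟩ := List.mem_map.1 this
      obtain ⟨l2, l3, rfl⟩ := List.append_of_mem hb
      exact ⟨[], a, l2, b, l3, by simp, hab.symm⟩
    · obtain ⟨l1, c, l2, b, l3, rfl, hc⟩ := ih hp
      exact ⟨a :: l1, c, l2, b, l3, by simp, hc⟩

theorem closed_sum {V A : Type*} (src tgt : A → V) (φ : A → ℚ)
    (h : ∀ p, IsDicycle src tgt p → (p.map φ).sum = 0) (n : ℕ) :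
    ∀ (p : List A) (u : V), p.length ≤ n → IsDiwalk src tgt u u p → (p.map φ).sum = 0 := by
  induction n with
  | zero =>
    intro p u hp _
    have : p = [] := List.length_eq_zero_iff.1 (by omega)
    simp [this]
  | succ n ih =>
    intro p u hp hw
    by_cases h0 : p = []
    · simp [h0]
    by_cases hd : (p.map tgt).Nodup
    · exact h p ⟨h0, u, hw, hd⟩
    obtain ⟨l1, a, l2, b, l3, rfl, hab⟩ := exists_dup tgt p hd
    rw [diwalk_append] at hw
    obtain ⟨v, h1, ha, h2⟩ := hw
    rw [diwalk_append] at h2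
    obtain ⟨w, h2, hb, h3⟩ := h2
    simp only [List.length_append, List.length_cons] at hp
    have e1 := ih (l1 ++ a :: l3) u (by simp; omega)
      ((diwalk_append ..).2 ⟨v, h1, ha, by rw [hab]; exact h3⟩)
    have e2 := ih (l2 ++ [b]) (tgt a) (by simp; omega)
      ((diwalk_append ..).2 ⟨w, h2, hb, hab.symm⟩)
    simp at e1 e2 ⊢
    linarith

theorem reach_all {V A : Type*} [Fintype A] (src tgt : A → V) (k : ℕ) (hk : 1 ≤ k)
    (hD : IsKConnected src tgt k) (u v : V) : ∃ p, IsDiwalk src tgt u v p := by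
  by_contra hc
  have := hD {v | ∃ p, IsDiwalk src tgt u v p} ⟨u, [], rfl⟩
    (fun h => hc (by have : v ∈ (Set.univ : Set V) := trivial
                     rw [← h] at this; exact this))
  have hpos : 0 < outdegS src tgt {v | ∃ p, IsDiwalk src tgt u v p} := by omega
  obtain ⟨⟨a, ⟨p, hp⟩, h2⟩⟩ := (Nat.card_pos_iff.1 hpos).1
  exact h2 ⟨p ++ [a], (diwalk_append ..).2 ⟨_, hp, rfl, rfl⟩⟩

theorem arcs_card {V A : Type*} [Fintype V] [Fintype A] (src tgt : A → V) (k : ℕ)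
    (hn : 2 ≤ Fintype.card V) (hD : IsKConnected src tgt k) :
    k * Fintype.card V ≤ Fintype.card A := by
  classical
  have h : ∀ v : V, k ≤ (Finset.univ.filter (fun a => src a = v)).card := by
    intro v
    have hne : ({v} : Set V) ≠ Set.univ := by
      intro h
      obtain ⟨w, hw⟩ := Fintype.exists_ne_of_one_lt_card (by omega) v
      have : w ∈ (Set.univ : Set V) := trivial
      rw [← h] at this
      exact hw this
    refine (hD {v} ⟨v, rfl⟩ hne).trans ?_
    unfold outdegS
    rw [Nat.card_eq_fintype_card, Fintype.card_subtype]
    apply Finset.card_le_card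
    intro a
    simp only [Finset.mem_filter, Set.mem_singleton_iff]
    tauto
  have := Finset.card_eq_sum_card_fiberwise (f := src) (s := Finset.univ) (t := Finset.univ)
    (fun _ _ => Finset.mem_coe.2 (Finset.mem_univ _))
  rw [← Finset.card_univ (α := A), this]
  calc k * Fintype.card V = ∑ v : V, k := by simp [mul_comm]
    _ ≤ _ := Finset.sum_le_sum fun v _ => h v

/-- The coboundary map. -/
def coboundary {V A : Type*} (src tgt : A → V) : (V → ℚ) →ₗ[ℚ] (A → ℚ) where
  toFun π a := π (tgt a) - π (src a)
  map_add' x y := by ext a; simp; ring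
  map_smul' c x := by ext a; simp; ring

theorem coboundary_rank {V A : Type*} [Fintype V] [Fintype A] [Nonempty V] (src tgt : A → V) :
    Module.finrank ℚ (LinearMap.range (coboundary src tgt)) + 1 ≤ Fintype.card V := by
  have h := LinearMap.finrank_range_add_finrank_ker (coboundary src tgt)
  rw [Module.finrank_fintype_fun_eq_card] at h
  have : 0 < Module.finrank ℚ (LinearMap.ker (coboundary src tgt)) := by
    rw [Module.finrank_pos_iff_exists_ne_zero]
    refine ⟨⟨fun _ => 1, ?_⟩, ?_⟩
    · rw [LinearMap.mem_ker]; ext a; simp [coboundary]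
    · intro hc
      have := congrFun (congrArg Subtype.val hc) (Classical.arbitrary V)
      simp at this
  omega

open Classical in
/-- Sum of a function on arcs over each member of a family of arc sets. -/
noncomputable def evalFam {A : Type*} [Fintype A] (S : Set (Set A)) :
    (A → ℚ) →ₗ[ℚ] (S → ℚ) where
  toFun φ C := ∑ a ∈ Finset.univ.filter (fun a => a ∈ C.1), φ a
  map_add' x y := by ext C; simp [Finset.sum_add_distrib]
  map_smul' c x := by ext C; simp [Finset.mul_sum]

theorem stmt_15 {V A : Type*} [Fintype V] [Fintype A]
    (src tgt : A → V) (hloop : ∀ a, src a ≠ tgt a)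
    (k : ℕ) (hk : 1 ≤ k) (hn : 2 ≤ Fintype.card V)
    (hD : IsKConnected src tgt k) :
    (k - 1) * Fintype.card V + 1 ≤
      Nat.card {C : Set A | ∃ p, IsDicycle src tgt p ∧ C = {a | a ∈ p}} := by
  classical
  set S : Set (Set A) := {C : Set A | ∃ p, IsDicycle src tgt p ∧ C = {a | a ∈ p}} with hS
  have hV : Nonempty V := Fintype.card_pos_iff.1 (by omega)
  have hr := coboundary_rank src tgt
  have hm := arcs_card src tgt k hn hD
  have hle : LinearMap.ker (evalFam S) ≤ LinearMap.range (coboundary src tgt) := by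
    intro φ hφ
    have hcyc : ∀ p, IsDicycle src tgt p → (p.map φ).sum = 0 := by
      intro p hp
      have h1 := congrFun (LinearMap.mem_ker.1 hφ) ⟨{a | a ∈ p}, p, hp, rfl⟩
      have hnd : (p.map tgt).Nodup := hp.2.choose_spec.2
      rw [← List.sum_toFinset φ hnd.of_map]
      rw [Pi.zero_apply] at h1
      rw [← h1]
      apply Finset.sum_congr _ (fun _ _ => rfl)
      ext a; simp
    have hcl : ∀ p u, IsDiwalk src tgt u u p → (p.map φ).sum = 0 :=
      fun p u hw => closed_sum src tgt φ hcyc p.length p u le_rfl hw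
    obtain ⟨r⟩ := hV
    choose P hP using reach_all src tgt k hk hD r
    refine ⟨fun v => ((P v).map φ).sum, ?_⟩
    ext a
    obtain ⟨q, hq⟩ := reach_all src tgt k hk hD (tgt a) r
    have e1 := hcl (P (tgt a) ++ q) r ((diwalk_append ..).2 ⟨_, hP _, hq⟩)
    have e2 := hcl (P (src a) ++ a :: q) r ((diwalk_append ..).2 ⟨_, hP _, rfl, hq⟩)
    simp [coboundary] at e1 e2 ⊢
    linarith
  have h1 := Submodule.finrank_mono hle
  have h2 := LinearMap.finrank_range_add_finrank_ker (evalFam S)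
  have h3 := Submodule.finrank_le (LinearMap.range (evalFam S))
  rw [Module.finrank_fintype_fun_eq_card] at h2 h3
  rw [Nat.card_eq_fintype_card]
  obtain ⟨j, rfl⟩ : ∃ j, k = j + 1 := ⟨k - 1, by omega⟩
  rw [add_mul] at hm
  simp only [Nat.add_sub_cancel]
  omega
end
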